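/- (Power theorem.) Let E, F be linear subspaces of a real vector space, each with a quasi-norm, let ρ₀, ρ₁ > 0, 0 < η < 1, 0 < r < ∞, and set ρ = (1−η)ρ₀ + ηρ₁, ν = ηρ₁/ρ, q = ρr. Then there exist constants c, C > 0 such that for every f ∈ E + F: c · ((∫₀^∞ (t^{−ν} K(f,t,E,F))^{q} dt/t)^{1/q})^{ρ} ≤ (∫₀^∞ (t^{−η} K_ρ(f,t))^{r} dt/t)^{1/r} ≤ C · ((∫₀^∞ (t^{−ν} K(f,t,E,F))^{q} dt/t)^{1/q})^{ρ}, where K_ρ(f,t) = inf{‖f₀‖_E^{ρ₀} + t‖f₁‖_F^{ρ₁} : f = f₀ + f₁, f₀ ∈ E, f₁ ∈ F} is the K-functional of the powered pair ((E)^{ρ₀}, (F)^{ρ₁}) and the quantities are simultaneously finite or infinite. That is, ((E)^{ρ₀},(F)^{ρ₁})^K_{η,r} = ((E,F)^K_{ν,q})^{ρ}. -/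

import Mathlib

open MeasureTheory Set Filter
open scoped ENNReal

variable {V : Type*} [AddCommGroup V] [Module ℝ V]

/-- `N` is a quasi-norm on the linear subspace `S` of `V`. -/
structure IsQuasiNorm (S : Submodule ℝ V) (N : V → ℝ) : Prop where
  nonneg : ∀ f ∈ S, 0 ≤ N f
  eq_zero_iff : ∀ f ∈ S, (N f = 0 ↔ f = 0)
  norm_neg : ∀ f ∈ S, N (-f) = N f
  triangle : ∃ C : ℝ, 1 ≤ C ∧ ∀ f₁ ∈ S, ∀ f₂ ∈ S, N (f₁ + f₂) ≤ C * (N f₁ + N f₂)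

/-- The Peetre K-functional of the pair `(A, B)` of quasi-normed subspaces:
`K(f,t,A,B) = inf {‖f₀‖_A + t‖f₁‖_B : f = f₀ + f₁, f₀ ∈ A, f₁ ∈ B}`. -/
noncomputable def Kfun (A B : Submodule ℝ V) (NA NB : V → ℝ) (f : V) (t : ℝ) : ℝ :=
  sInf {x : ℝ | ∃ f₀ ∈ A, ∃ f₁ ∈ B, f = f₀ + f₁ ∧ x = NA f₀ + t * NB f₁}

/-- The approximation functional `𝓔(f,t) = inf {‖f - g‖_E : g ∈ P, ‖g‖_P ≤ t}`. -/
noncomputable def Efun (E P : Submodule ℝ V) (NE NP : V → ℝ) (f : V) (t : ℝ) : ℝ :=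
  sInf {x : ℝ | ∃ g ∈ P, NP g ≤ t ∧ x = NE (f - g)}

/-- Completeness of the quasi-normed subspace `(S, N)`: every Cauchy sequence converges. -/
def QComplete (S : Submodule ℝ V) (N : V → ℝ) : Prop :=
  ∀ u : ℕ → V, (∀ n, u n ∈ S) →
    Tendsto (fun p : ℕ × ℕ => N (u p.1 - u p.2)) atTop (nhds 0) →
    ∃ f ∈ S, Tendsto (fun n => N (u n - f)) atTop (nhds 0)

/-- The integral `∫₀^∞ (t^e · g t)^q dt/t`, valued in `ℝ≥0∞`. -/
noncomputable def qInt (g : ℝ → ℝ) (e q : ℝ) : ℝ≥0∞ :=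
  ∫⁻ t in Ioi (0 : ℝ), ENNReal.ofReal (t ^ e * g t) ^ q * ENNReal.ofReal t⁻¹

/-- The K-functional of the powered pair `((E)^{ρ₀}, (F)^{ρ₁})`:
`K_ρ(f,t) = inf {‖f₀‖_E^{ρ₀} + t ‖f₁‖_F^{ρ₁} : f = f₀ + f₁, f₀ ∈ E, f₁ ∈ F}`. -/
noncomputable def KfunPow (E F : Submodule ℝ V) (NE NF : V → ℝ) (ρ₀ ρ₁ : ℝ)
    (f : V) (t : ℝ) : ℝ :=
  sInf {x : ℝ | ∃ f₀ ∈ E, ∃ f₁ ∈ F, f = f₀ + f₁ ∧ x = NE f₀ ^ ρ₀ + t * NF f₁ ^ ρ₁}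

/-- The multiplicatively invariant measure `dt/t` on `(0, ∞)`. -/
noncomputable def mulHaarIoi : Measure ℝ :=
  (volume.restrict (Ioi (0 : ℝ))).withDensity fun t => ENNReal.ofReal t⁻¹

instance : SFinite mulHaarIoi := by
  unfold mulHaarIoi
  infer_instance

lemma lintegral_mulHaarIoi (g : ℝ → ℝ≥0∞) :
    ∫⁻ t, g t ∂mulHaarIoi = ∫⁻ t in Ioi (0 : ℝ), g t * ENNReal.ofReal t⁻¹ := by
  unfold mulHaarIoi
  rw [lintegral_withDensity_eq_lintegral_mul_non_measurable _ (by fun_prop)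
    (Eventually.of_forall fun _ => ENNReal.ofReal_lt_top)]
  simp only [Pi.mul_apply, mul_comm]

lemma ae_mulHaarIoi_pos : ∀ᵐ t ∂mulHaarIoi, 0 < t :=
  (withDensity_absolutelyContinuous _ _).ae_le (ae_restrict_mem measurableSet_Ioi)

lemma lintegral_mulHaarIoi_congr {g h : ℝ → ℝ≥0∞} (H : ∀ t, 0 < t → g t = h t) :
    ∫⁻ t, g t ∂mulHaarIoi = ∫⁻ t, h t ∂mulHaarIoi :=
  lintegral_congr_ae (ae_mulHaarIoi_pos.mono H)

lemma lintegral_mulHaarIoi_comp_rpow (g : ℝ → ℝ≥0∞) {c p : ℝ} (hc : 0 < c) (hp : p ≠ 0) :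
    ∫⁻ t, g t ∂mulHaarIoi = ENNReal.ofReal |p| * ∫⁻ y, g (c * y ^ p) ∂mulHaarIoi := by
  have himg : image (fun y : ℝ => c * y ^ p) (Ioi 0) = Ioi 0 := by
    ext t
    constructor
    · rintro ⟨y, hy, rfl⟩
      exact mul_pos hc (Real.rpow_pos_of_pos hy p)
    · intro ht
      have ht' : 0 < t / c := div_pos ht hc
      refine ⟨(t / c) ^ p⁻¹, Real.rpow_pos_of_pos ht' _, ?_⟩
      simp only [Real.rpow_inv_rpow ht'.le hp]
      field_simp
  have hinj : InjOn (fun y : ℝ => c * y ^ p) (Ioi 0) := by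
    intro y hy z hz h
    have h' : y ^ p = z ^ p := mul_left_cancel₀ hc.ne' h
    exact (Real.rpow_left_inj (le_of_lt hy) (le_of_lt hz) hp).1 h'
  have hder : ∀ y ∈ Ioi (0 : ℝ),
      HasDerivWithinAt (fun y : ℝ => c * y ^ p) (c * (p * y ^ (p - 1))) (Ioi 0) y := fun y hy =>
    ((Real.hasDerivAt_rpow_const (Or.inl (ne_of_gt hy))).const_mul c).hasDerivWithinAt
  rw [lintegral_mulHaarIoi, lintegral_mulHaarIoi]
  conv_lhs => rw [← himg]
  rw [lintegral_image_eq_lintegral_abs_deriv_mul measurableSet_Ioi hder hinj,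
    ← lintegral_const_mul' _ _ ENNReal.ofReal_ne_top]
  refine setLIntegral_congr_fun measurableSet_Ioi fun y hy => ?_
  have hy : 0 < y := hy
  have hyp := Real.rpow_pos_of_pos hy p
  have key : ENNReal.ofReal |c * (p * y ^ (p - 1))| * ENNReal.ofReal (c * y ^ p)⁻¹ =
      ENNReal.ofReal |p| * ENNReal.ofReal y⁻¹ := by
    rw [← ENNReal.ofReal_mul (abs_nonneg _), ← ENNReal.ofReal_mul (abs_nonneg _),
      Real.rpow_sub_one hy.ne', abs_mul, abs_mul, abs_of_pos hc, abs_of_pos (div_pos hyp hy)]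
    congr 1
    field_simp
  calc _ = g (c * y ^ p) * (ENNReal.ofReal |c * (p * y ^ (p - 1))| *
        ENNReal.ofReal (c * y ^ p)⁻¹) := by ring
    _ = _ := by rw [key]; ring

lemma ofReal_rpow_eq_lintegral_mulHaarIoi {k r : ℝ} (hk : 0 ≤ k) (hr : 0 < r) :
    ENNReal.ofReal (k ^ r) = ENNReal.ofReal r *
      ∫⁻ x, (Iic k).indicator (fun x => ENNReal.ofReal (x ^ r)) x ∂mulHaarIoi := by
  have h1 : ∫⁻ x, (Iic k).indicator (fun x => ENNReal.ofReal (x ^ r)) x ∂mulHaarIoi =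
      ∫⁻ x in Ioc 0 k, ENNReal.ofReal (x ^ (r - 1)) := by
    rw [lintegral_mulHaarIoi, ← Ioi_inter_Iic, inter_comm,
      ← Measure.restrict_restrict measurableSet_Iic, ← lintegral_indicator measurableSet_Iic]
    refine setLIntegral_congr_fun measurableSet_Ioi fun x hx => ?_
    have hx : 0 < x := hx
    by_cases hxk : x ∈ Iic k
    · simp only [indicator_of_mem hxk]
      rw [← ENNReal.ofReal_mul (by positivity), Real.rpow_sub_one hx.ne', div_eq_mul_inv]
    · simp only [indicator_of_notMem hxk, zero_mul]
  have h2 : IntervalIntegrable (fun x : ℝ => x ^ (r - 1)) volume 0 k :=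
    intervalIntegral.intervalIntegrable_rpow' (by linarith)
  have h3 : ∫ x in Ioc 0 k, x ^ (r - 1) = k ^ r / r := by
    rw [← intervalIntegral.integral_of_le hk, integral_rpow (Or.inl (by linarith))]
    simp [Real.zero_rpow hr.ne']
  rw [h1, ← ofReal_integral_eq_lintegral_ofReal
    ((intervalIntegrable_iff_integrableOn_Ioc_of_le hk).1 h2)
    ((ae_restrict_mem measurableSet_Ioc).mono fun x hx => Real.rpow_nonneg hx.1.le _),
    h3, ← ENNReal.ofReal_mul hr.le]
  congr 1
  field_simp

/-- The closed set of points of the plane with no point of `S` strictly below them. -/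
def lowerRegion (S : Set (ℝ × ℝ)) : Set (ℝ × ℝ) :=
  {w | ¬ ∃ z ∈ S, z.1 < w.1 ∧ z.2 < w.2}

lemma measurableSet_lowerRegion (S : Set (ℝ × ℝ)) : MeasurableSet (lowerRegion S) := by
  have h : lowerRegion S = (⋃ z ∈ S, Ioi z.1 ×ˢ Ioi z.2)ᶜ := by
    ext w
    simp only [lowerRegion, mem_ofPred_eq, mem_compl_iff, mem_iUnion, mem_prod, mem_Ioi,
      exists_prop]
  rw [h]
  exact (isOpen_biUnion fun z _ => isOpen_Ioi.prod isOpen_Ioi).measurableSet.compl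

/-- The variant of the K-functional with the maximum in place of the sum, for the set `S` of
pairs of quasi-norms of admissible decompositions. -/
noncomputable def Kmax (S : Set (ℝ × ℝ)) (ρ₀ ρ₁ t : ℝ) : ℝ :=
  sInf (image (fun z : ℝ × ℝ => max (z.1 ^ ρ₀) (t * z.2 ^ ρ₁)) S)

/-- The K-functional for powers `ρ₀`, `ρ₁`, for the set `S` of pairs of quasi-norms of admissible
decompositions. -/
noncomputable def Ksum (S : Set (ℝ × ℝ)) (ρ₀ ρ₁ t : ℝ) : ℝ :=
  sInf (image (fun z : ℝ × ℝ => z.1 ^ ρ₀ + t * z.2 ^ ρ₁) S)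

lemma Kmax_nonneg {S : Set (ℝ × ℝ)} (hpos : ∀ z ∈ S, 0 ≤ z.1 ∧ 0 ≤ z.2) (ρ₀ ρ₁ t : ℝ) :
    0 ≤ Kmax S ρ₀ ρ₁ t := by
  refine Real.sInf_nonneg ?_
  rintro _ ⟨z, hz, rfl⟩
  exact le_max_of_le_left (Real.rpow_nonneg (hpos z hz).1 _)

lemma Kmax_le {S : Set (ℝ × ℝ)} (hpos : ∀ z ∈ S, 0 ≤ z.1 ∧ 0 ≤ z.2) (ρ₀ ρ₁ t : ℝ)
    {z : ℝ × ℝ} (hz : z ∈ S) : Kmax S ρ₀ ρ₁ t ≤ max (z.1 ^ ρ₀) (t * z.2 ^ ρ₁) := by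
  refine csInf_le ⟨0, ?_⟩ (mem_image_of_mem _ hz)
  rintro _ ⟨z, hz, rfl⟩
  exact le_max_of_le_left (Real.rpow_nonneg (hpos z hz).1 _)

lemma Kmax_le_Ksum {S : Set (ℝ × ℝ)} (hS : S.Nonempty) (hpos : ∀ z ∈ S, 0 ≤ z.1 ∧ 0 ≤ z.2)
    (ρ₀ ρ₁ : ℝ) {t : ℝ} (ht : 0 < t) : Kmax S ρ₀ ρ₁ t ≤ Ksum S ρ₀ ρ₁ t := by
  refine le_csInf (hS.image _) ?_
  rintro _ ⟨z, hz, rfl⟩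
  have h0 := Real.rpow_nonneg (hpos z hz).1 ρ₀
  have h1 := mul_nonneg ht.le (Real.rpow_nonneg (hpos z hz).2 ρ₁)
  exact (Kmax_le hpos ρ₀ ρ₁ t hz).trans (max_le (by linarith) (by linarith))

lemma Ksum_le_two_mul_Kmax {S : Set (ℝ × ℝ)} (hS : S.Nonempty)
    (hpos : ∀ z ∈ S, 0 ≤ z.1 ∧ 0 ≤ z.2) (ρ₀ ρ₁ : ℝ) {t : ℝ} (ht : 0 < t) :
    Ksum S ρ₀ ρ₁ t ≤ 2 * Kmax S ρ₀ ρ₁ t := by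
  have h : Ksum S ρ₀ ρ₁ t / 2 ≤ Kmax S ρ₀ ρ₁ t := by
    refine le_csInf (hS.image _) ?_
    rintro _ ⟨z, hz, rfl⟩
    have hle : Ksum S ρ₀ ρ₁ t ≤ z.1 ^ ρ₀ + t * z.2 ^ ρ₁ := by
      refine csInf_le ⟨0, ?_⟩ (mem_image_of_mem _ hz)
      rintro _ ⟨z, hz, rfl⟩
      exact add_nonneg (Real.rpow_nonneg (hpos z hz).1 _)
        (mul_nonneg ht.le (Real.rpow_nonneg (hpos z hz).2 _))
    have h0 := le_max_left (z.1 ^ ρ₀) (t * z.2 ^ ρ₁)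
    have h1 := le_max_right (z.1 ^ ρ₀) (t * z.2 ^ ρ₁)
    change _ ≤ max (z.1 ^ ρ₀) (t * z.2 ^ ρ₁)
    linarith
  linarith

lemma le_Kmax_iff {S : Set (ℝ × ℝ)} (hS : S.Nonempty) (hpos : ∀ z ∈ S, 0 ≤ z.1 ∧ 0 ≤ z.2)
    {ρ₀ ρ₁ s t : ℝ} (hρ₀ : 0 < ρ₀) (hρ₁ : 0 < ρ₁) (hs : 0 < s) (ht : 0 < t) :
    s ^ ρ₀ ≤ Kmax S ρ₀ ρ₁ t ↔ (s, (s ^ ρ₀ / t) ^ ρ₁⁻¹) ∈ lowerRegion S := by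
  have hbdd : BddBelow (image (fun z : ℝ × ℝ => max (z.1 ^ ρ₀) (t * z.2 ^ ρ₁)) S) := by
    refine ⟨0, ?_⟩
    rintro _ ⟨z, hz, rfl⟩
    exact le_max_of_le_left (Real.rpow_nonneg (hpos z hz).1 _)
  have hst : 0 < s ^ ρ₀ / t := div_pos (Real.rpow_pos_of_pos hs _) ht
  rw [← not_lt, Kmax, csInf_lt_iff hbdd (hS.image _), lowerRegion, mem_ofPred_eq, not_iff_not,
    exists_mem_image]
  refine exists_congr fun z => and_congr_right fun hz => ?_
  rw [max_lt_iff, Real.rpow_lt_rpow_iff (hpos z hz).1 hs.le hρ₀,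
    Real.lt_rpow_inv_iff_of_pos (hpos z hz).2 hst.le hρ₁, lt_div_iff₀' ht]

/-- The weighted area `∬ x^a y^b dx/x dy/y` of the region below `S`. -/
noncomputable def regionIntegral (S : Set (ℝ × ℝ)) (a b : ℝ) : ℝ≥0∞ :=
  ∫⁻ x, ∫⁻ y, (lowerRegion S).indicator
    (fun w => ENNReal.ofReal (w.1 ^ a) * ENNReal.ofReal (w.2 ^ b)) (x, y)
      ∂mulHaarIoi ∂mulHaarIoi

lemma qInt_eq_lintegral_mulHaarIoi (g : ℝ → ℝ) (e q : ℝ) :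
    qInt g e q = ∫⁻ t, ENNReal.ofReal (t ^ e * g t) ^ q ∂mulHaarIoi := by
  rw [lintegral_mulHaarIoi, qInt]

lemma ofReal_Kmax_rpow {S : Set (ℝ × ℝ)} (hS : S.Nonempty)
    (hpos : ∀ z ∈ S, 0 ≤ z.1 ∧ 0 ≤ z.2) {ρ₀ ρ₁ r t : ℝ} (hρ₀ : 0 < ρ₀) (hρ₁ : 0 < ρ₁)
    (hr : 0 < r) (ht : 0 < t) :
    ENNReal.ofReal (Kmax S ρ₀ ρ₁ t ^ r) = ENNReal.ofReal (r * ρ₀) *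
      ∫⁻ s, (lowerRegion S).indicator (fun w => ENNReal.ofReal (w.1 ^ (ρ₀ * r)))
        (s, (s ^ ρ₀ / t) ^ ρ₁⁻¹) ∂mulHaarIoi := by
  rw [ofReal_rpow_eq_lintegral_mulHaarIoi (Kmax_nonneg hpos _ _ _) hr,
    lintegral_mulHaarIoi_comp_rpow _ one_pos hρ₀.ne', ENNReal.ofReal_mul hr.le, mul_assoc,
    abs_of_pos hρ₀]
  congr 2
  refine lintegral_mulHaarIoi_congr fun s hs => ?_
  have h := le_Kmax_iff hS hpos hρ₀ hρ₁ hs ht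
  rw [one_mul]
  by_cases hw : s ^ ρ₀ ≤ Kmax S ρ₀ ρ₁ t
  · rw [indicator_of_mem (mem_Iic.2 hw), indicator_of_mem (h.1 hw), Real.rpow_mul hs.le]
  · rw [indicator_of_notMem (mt mem_Iic.1 hw), indicator_of_notMem (mt h.2 hw)]

lemma qInt_Kmax {S : Set (ℝ × ℝ)} (hS : S.Nonempty) (hpos : ∀ z ∈ S, 0 ≤ z.1 ∧ 0 ≤ z.2)
    {ρ₀ ρ₁ r : ℝ} (η : ℝ) (hρ₀ : 0 < ρ₀) (hρ₁ : 0 < ρ₁) (hr : 0 < r) :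
    qInt (Kmax S ρ₀ ρ₁) (-η) r =
      ENNReal.ofReal (r * ρ₀ * ρ₁) * regionIntegral S ((1 - η) * ρ₀ * r) (η * ρ₁ * r) := by
  have hmeas : Measurable (Function.uncurry fun t s : ℝ => ENNReal.ofReal (t ^ (-η * r)) *
      (lowerRegion S).indicator (fun w => ENNReal.ofReal (w.1 ^ (ρ₀ * r)))
        (s, (s ^ ρ₀ / t) ^ ρ₁⁻¹)) := by
    have h1 : Measurable ((lowerRegion S).indicator
        (fun w : ℝ × ℝ => ENNReal.ofReal (w.1 ^ (ρ₀ * r)))) :=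
      Measurable.indicator (by fun_prop) (measurableSet_lowerRegion S)
    have h2 : Measurable fun p : ℝ × ℝ => (p.2, (p.2 ^ ρ₀ / p.1) ^ ρ₁⁻¹) := by fun_prop
    have h3 : Measurable fun p : ℝ × ℝ => ENNReal.ofReal (p.1 ^ (-η * r)) := by fun_prop
    exact h3.mul (h1.comp h2)
  rw [qInt_eq_lintegral_mulHaarIoi]
  calc _ = ∫⁻ t, ENNReal.ofReal (r * ρ₀) * ∫⁻ s, ENNReal.ofReal (t ^ (-η * r)) *
          (lowerRegion S).indicator (fun w => ENNReal.ofReal (w.1 ^ (ρ₀ * r)))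
          (s, (s ^ ρ₀ / t) ^ ρ₁⁻¹) ∂mulHaarIoi ∂mulHaarIoi := by
        refine lintegral_mulHaarIoi_congr fun t ht => ?_
        have hK := Kmax_nonneg hpos ρ₀ ρ₁ t
        have ht' : 0 ≤ t ^ (-η) := Real.rpow_nonneg ht.le _
        rw [ENNReal.ofReal_rpow_of_nonneg (mul_nonneg ht' hK) hr.le, Real.mul_rpow ht' hK,
          ENNReal.ofReal_mul (Real.rpow_nonneg ht' _), ofReal_Kmax_rpow hS hpos hρ₀ hρ₁ hr ht,
          ← Real.rpow_mul ht.le, lintegral_const_mul' _ _ ENNReal.ofReal_ne_top]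
        ring
    _ = ENNReal.ofReal (r * ρ₀) * ∫⁻ s, ENNReal.ofReal ρ₁ * ∫⁻ y, (lowerRegion S).indicator
          (fun w => ENNReal.ofReal (w.1 ^ ((1 - η) * ρ₀ * r)) *
            ENNReal.ofReal (w.2 ^ (η * ρ₁ * r))) (s, y) ∂mulHaarIoi ∂mulHaarIoi := by
        rw [lintegral_const_mul' _ _ ENNReal.ofReal_ne_top,
          lintegral_lintegral_swap hmeas.aemeasurable]
        congr 1
        refine lintegral_mulHaarIoi_congr fun s hs => ?_
        have hsρ : 0 < s ^ ρ₀ := Real.rpow_pos_of_pos hs _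
        rw [lintegral_mulHaarIoi_comp_rpow _ hsρ (neg_ne_zero.2 hρ₁.ne'), abs_neg,
          abs_of_pos hρ₁]
        congr 1
        refine lintegral_mulHaarIoi_congr fun y hy => ?_
        have hyρ : 0 < y ^ ρ₁ := Real.rpow_pos_of_pos hy _
        have h1 : (s ^ ρ₀ / (s ^ ρ₀ * y ^ (-ρ₁))) ^ ρ₁⁻¹ = y := by
          rw [Real.rpow_neg hy.le, div_mul_cancel_left₀ hsρ.ne', inv_inv,
            Real.rpow_rpow_inv hy.le hρ₁.ne']
        rw [h1]
        by_cases hw : (s, y) ∈ lowerRegion S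
        · simp only [indicator_of_mem hw]
          rw [← ENNReal.ofReal_mul (by positivity), ← ENNReal.ofReal_mul (by positivity)]
          congr 1
          rw [Real.mul_rpow hsρ.le (by positivity), ← Real.rpow_mul hs.le, ← Real.rpow_mul hy.le,
            mul_right_comm, ← Real.rpow_add hs]
          congr 2 <;> ring
        · simp only [indicator_of_notMem hw, mul_zero]
    _ = _ := by
        rw [lintegral_const_mul' _ _ ENNReal.ofReal_ne_top, ← mul_assoc,
          ← ENNReal.ofReal_mul (by positivity), regionIntegral]

lemma qInt_le_of_le_mul {g h : ℝ → ℝ} {q k : ℝ} (e : ℝ) (hq : 0 ≤ q) (hk : 0 ≤ k)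
    (H : ∀ t, 0 < t → g t ≤ k * h t) :
    qInt g e q ≤ ENNReal.ofReal (k ^ q) * qInt h e q := by
  rw [qInt_eq_lintegral_mulHaarIoi, qInt_eq_lintegral_mulHaarIoi,
    ← lintegral_const_mul' _ _ ENNReal.ofReal_ne_top]
  refine lintegral_mono_ae (ae_mulHaarIoi_pos.mono fun t ht => ?_)
  rw [← ENNReal.ofReal_rpow_of_nonneg hk hq, ← ENNReal.mul_rpow_of_nonneg _ _ hq,
    ← ENNReal.ofReal_mul hk]
  refine ENNReal.rpow_le_rpow (ENNReal.ofReal_le_ofReal ?_) hq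
  calc t ^ e * g t ≤ t ^ e * (k * h t) :=
        mul_le_mul_of_nonneg_left (H t ht) (Real.rpow_nonneg ht.le _)
    _ = k * (t ^ e * h t) := by ring

lemma regionIntegral_le_qInt_Ksum {S : Set (ℝ × ℝ)} (hS : S.Nonempty)
    (hpos : ∀ z ∈ S, 0 ≤ z.1 ∧ 0 ≤ z.2) {ρ₀ ρ₁ r : ℝ} (η : ℝ) (hρ₀ : 0 < ρ₀) (hρ₁ : 0 < ρ₁)
    (hr : 0 < r) :
    ENNReal.ofReal (r * ρ₀ * ρ₁) * regionIntegral S ((1 - η) * ρ₀ * r) (η * ρ₁ * r) ≤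
      qInt (Ksum S ρ₀ ρ₁) (-η) r := by
  rw [← qInt_Kmax hS hpos η hρ₀ hρ₁ hr]
  simpa using qInt_le_of_le_mul (-η) hr.le zero_le_one fun t ht =>
    (Kmax_le_Ksum hS hpos ρ₀ ρ₁ ht).trans_eq (one_mul _).symm

lemma qInt_Ksum_le_regionIntegral {S : Set (ℝ × ℝ)} (hS : S.Nonempty)
    (hpos : ∀ z ∈ S, 0 ≤ z.1 ∧ 0 ≤ z.2) {ρ₀ ρ₁ r : ℝ} (η : ℝ) (hρ₀ : 0 < ρ₀) (hρ₁ : 0 < ρ₁)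
    (hr : 0 < r) :
    qInt (Ksum S ρ₀ ρ₁) (-η) r ≤ ENNReal.ofReal (2 ^ r * (r * ρ₀ * ρ₁)) *
      regionIntegral S ((1 - η) * ρ₀ * r) (η * ρ₁ * r) := by
  rw [ENNReal.ofReal_mul (by positivity), mul_assoc, ← qInt_Kmax hS hpos η hρ₀ hρ₁ hr]
  exact qInt_le_of_le_mul (-η) hr.le zero_le_two fun t ht =>
    Ksum_le_two_mul_Kmax hS hpos ρ₀ ρ₁ ht

/-- The pairs of quasi-norms of the decompositions `f = f₀ + f₁` with `f₀ ∈ E`, `f₁ ∈ F`. -/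
def normPairs (E F : Submodule ℝ V) (NE NF : V → ℝ) (f : V) : Set (ℝ × ℝ) :=
  {z | ∃ f₀ ∈ E, ∃ f₁ ∈ F, f = f₀ + f₁ ∧ z = (NE f₀, NF f₁)}

lemma KfunPow_eq_Ksum (E F : Submodule ℝ V) (NE NF : V → ℝ) (ρ₀ ρ₁ : ℝ) (f : V) :
    KfunPow E F NE NF ρ₀ ρ₁ f = Ksum (normPairs E F NE NF f) ρ₀ ρ₁ := by
  ext t
  unfold KfunPow Ksum
  congr 1
  ext x
  constructor
  · rintro ⟨f₀, h₀, f₁, h₁, hf, rfl⟩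
    exact ⟨_, ⟨f₀, h₀, f₁, h₁, hf, rfl⟩, rfl⟩
  · rintro ⟨_, ⟨f₀, h₀, f₁, h₁, hf, rfl⟩, rfl⟩
    exact ⟨f₀, h₀, f₁, h₁, hf, rfl⟩

lemma Kfun_eq_Ksum (E F : Submodule ℝ V) (NE NF : V → ℝ) (f : V) :
    Kfun E F NE NF f = Ksum (normPairs E F NE NF f) 1 1 := by
  rw [← KfunPow_eq_Ksum]
  ext t
  simp only [Kfun, KfunPow, Real.rpow_one]

lemma le_ofReal_div_mul {a b z : ℝ≥0∞} {k K : ℝ} (hk : 0 < k) (hK : 0 ≤ K)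
    (ha : a ≤ ENNReal.ofReal K * z) (hb : ENNReal.ofReal k * z ≤ b) :
    a ≤ ENNReal.ofReal (K / k) * b := by
  calc a ≤ ENNReal.ofReal (K / k * k) * z := by rwa [div_mul_cancel₀ _ hk.ne']
    _ = ENNReal.ofReal (K / k) * (ENNReal.ofReal k * z) := by
        rw [ENNReal.ofReal_mul (by positivity), mul_assoc]
    _ ≤ _ := by gcongr

lemma rpow_le_ofReal_rpow_mul {a b : ℝ≥0∞} {k p : ℝ} (hk : 0 ≤ k) (hp : 0 ≤ p)
    (h : a ≤ ENNReal.ofReal k * b) : a ^ p ≤ ENNReal.ofReal (k ^ p) * b ^ p := by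
  rw [← ENNReal.ofReal_rpow_of_nonneg hk hp, ← ENNReal.mul_rpow_of_nonneg _ _ hp]
  exact ENNReal.rpow_le_rpow h hp

/-- **The Power Theorem.** With `ρ = (1−η)ρ₀ + ηρ₁`, `ν = ηρ₁/ρ` and `q = ρr`, one has
`((E)^{ρ₀}, (F)^{ρ₁})^K_{η,r} = ((E,F)^K_{ν,q})^{ρ}` with equivalent quasi-norms. -/
theorem power_theorem
    (E F : Submodule ℝ V) (NE NF : V → ℝ)
    (hNE : IsQuasiNorm E NE) (hNF : IsQuasiNorm F NF)
    (ρ₀ ρ₁ η r : ℝ) (hρ₀ : 0 < ρ₀) (hρ₁ : 0 < ρ₁)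
    (hη₀ : 0 < η) (hη₁ : η < 1) (hr : 0 < r) :
    ∃ c C : ℝ, 0 < c ∧ 0 < C ∧ ∀ f ∈ E ⊔ F,
      ENNReal.ofReal c *
          ((qInt (Kfun E F NE NF f) (-(η * ρ₁ / ((1 - η) * ρ₀ + η * ρ₁)))
              (((1 - η) * ρ₀ + η * ρ₁) * r)) ^
            (1 / (((1 - η) * ρ₀ + η * ρ₁) * r))) ^ ((1 - η) * ρ₀ + η * ρ₁) ≤
        (qInt (KfunPow E F NE NF ρ₀ ρ₁ f) (-η) r) ^ (1 / r) ∧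
      (qInt (KfunPow E F NE NF ρ₀ ρ₁ f) (-η) r) ^ (1 / r) ≤
        ENNReal.ofReal C *
          ((qInt (Kfun E F NE NF f) (-(η * ρ₁ / ((1 - η) * ρ₀ + η * ρ₁)))
              (((1 - η) * ρ₀ + η * ρ₁) * r)) ^
            (1 / (((1 - η) * ρ₀ + η * ρ₁) * r))) ^ ((1 - η) * ρ₀ + η * ρ₁) := by
  have hρ : 0 < (1 - η) * ρ₀ + η * ρ₁ :=
    add_pos (mul_pos (sub_pos.2 hη₁) hρ₀) (mul_pos hη₀ hρ₁)
  set ρ := (1 - η) * ρ₀ + η * ρ₁ with hρ_def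
  have hq : 0 < ρ * r := mul_pos hρ hr
  have hA : 0 < 2 ^ (ρ * r) * (ρ * r * 1 * 1) / (r * ρ₀ * ρ₁) := by positivity
  have hB : 0 < 2 ^ r * (r * ρ₀ * ρ₁) / (ρ * r * 1 * 1) := by positivity
  refine ⟨((2 ^ (ρ * r) * (ρ * r * 1 * 1) / (r * ρ₀ * ρ₁)) ^ (1 / r))⁻¹,
    (2 ^ r * (r * ρ₀ * ρ₁) / (ρ * r * 1 * 1)) ^ (1 / r), by positivity, by positivity,
    fun f hf => ?_⟩
  have hS : (normPairs E F NE NF f).Nonempty := by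
    obtain ⟨f₀, h₀, f₁, h₁, h⟩ := Submodule.mem_sup.1 hf
    exact ⟨_, f₀, h₀, f₁, h₁, h.symm, rfl⟩
  have hpos : ∀ z ∈ normPairs E F NE NF f, 0 ≤ z.1 ∧ 0 ≤ z.2 := by
    rintro _ ⟨f₀, h₀, f₁, h₁, -, rfl⟩
    exact ⟨hNE.nonneg f₀ h₀, hNF.nonneg f₁ h₁⟩
  rw [Kfun_eq_Ksum, KfunPow_eq_Ksum, ← ENNReal.rpow_mul,
    show 1 / (ρ * r) * ρ = 1 / r by field_simp]
  have e₀ : (1 - η * ρ₁ / ρ) * 1 * (ρ * r) = (1 - η) * ρ₀ * r := by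
    field_simp
    rw [hρ_def]
    ring
  have e₁ : η * ρ₁ / ρ * 1 * (ρ * r) = η * ρ₁ * r := by field_simp
  have I₁ := regionIntegral_le_qInt_Ksum hS hpos (η * ρ₁ / ρ) one_pos one_pos hq
  have I₂ := qInt_Ksum_le_regionIntegral hS hpos (η * ρ₁ / ρ) one_pos one_pos hq
  rw [e₀, e₁] at I₁ I₂
  have J₁ := regionIntegral_le_qInt_Ksum hS hpos η hρ₀ hρ₁ hr
  have J₂ := qInt_Ksum_le_regionIntegral hS hpos η hρ₀ hρ₁ hr
  have hr' : 0 ≤ 1 / r := by positivity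
  constructor
  · have h := rpow_le_ofReal_rpow_mul hA.le hr'
      (le_ofReal_div_mul (by positivity) (by positivity) I₂ J₁)
    rw [ENNReal.ofReal_inv_of_pos (by positivity)]
    exact (ENNReal.inv_mul_le_iff (ENNReal.ofReal_pos.2 (by positivity)).ne'
      ENNReal.ofReal_ne_top).2 h
  · exact rpow_le_ofReal_rpow_mul hB.le hr'
      (le_ofReal_div_mul (by positivity) (by positivity) J₂ I₁)
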